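/- There is a constant C > 0, independent of T and ψ, such that for every T > 0 and every smooth function ψ on [0,T]×ℝ³ which is Schwartz in the space variable for each t, one has ‖∇ψ‖_{L⁴_T(L⁴(ℝ³))} ≤ C ‖∇_h∇ψ‖_{L²_T(L²(ℝ³))}^{1/2} ‖∇ψ‖_{L^∞_T(H¹(ℝ³))}^{1/2}. -/

import Mathlib

open MeasureTheory Real Set Filter
open scoped ENNReal NNReal

noncomputable section

/-- Spatial points of `ℝ³`. -/
abbrev Pt : Type := Fin 3 → ℝ

/-- Partial derivative in the `i`-th coordinate direction. -/
def pd (i : Fin 3) (f : Pt → ℝ) : Pt → ℝ := fun x => fderiv ℝ f x (Pi.single i 1)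

/-- Iterated partial derivative `∂^α` for a multi-index `α`. -/
def pdM (α : Fin 3 → ℕ) (f : Pt → ℝ) : Pt → ℝ :=
  (pd 0)^[α 0] ((pd 1)^[α 1] ((pd 2)^[α 2] f))

/-- Multi-indices of total degree at most `k`. -/
def midx (k : ℕ) : Finset (Fin 3 → ℕ) :=
  (Fintype.piFinset fun _ => Finset.range (k + 1)).filter fun α => ∑ i, α i ≤ k

/-- The `H^k` inner product `(f|g)_{H^k} = ∑_{|α| ≤ k} ∫ ∂^α f ∂^α g`. -/
def hInner (k : ℕ) (f g : Pt → ℝ) : ℝ := ∑ α ∈ midx k, ∫ x : Pt, pdM α f x * pdM α g x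

/-- The squared `H^k` norm. -/
def hSq (k : ℕ) (f : Pt → ℝ) : ℝ := hInner k f f

/-- The squared `L²` norm. -/
def l2Sq (f : Pt → ℝ) : ℝ := ∫ x : Pt, (f x) ^ 2

/-- The Laplacian. -/
def lapl (f : Pt → ℝ) : Pt → ℝ := fun x => ∑ i, pd i (pd i f) x

/-- Horizontal directions. -/
def hIdx : Finset (Fin 3) := {0, 1}

/-- `L^∞` norm in time over `[0,T]` of a (nonnegative) function of time. -/
def supT (T : ℝ) (g : ℝ → ℝ) : ℝ := sSup (g '' Icc 0 T)

/-- `L²` norm in time over `[0,T]`. -/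
def l2T (T : ℝ) (g : ℝ → ℝ) : ℝ := Real.sqrt (∫ t in (0:ℝ)..T, (g t) ^ 2)

/-- `L⁴` norm in time over `[0,T]`. -/
def l4T (T : ℝ) (g : ℝ → ℝ) : ℝ := (∫ t in (0:ℝ)..T, (g t) ^ 4) ^ ((1:ℝ)/4)

/-- A function is Schwartz: smooth with all derivatives rapidly decaying. -/
def IsSchwartz (f : Pt → ℝ) : Prop :=
  ContDiff ℝ (⊤ : ℕ∞) f ∧ ∀ k n : ℕ, ∃ C : ℝ, ∀ x, ‖x‖ ^ k * ‖iteratedFDeriv ℝ n f x‖ ≤ C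

/-- Smoothness of `f` jointly in `(t,x)` on `s ×ˢ ℝ³`. -/
def SmoothOn2 (s : Set ℝ) (f : ℝ → Pt → ℝ) : Prop :=
  ContDiffOn ℝ (⊤ : ℕ∞) (fun q : ℝ × Pt => f q.1 q.2) (s ×ˢ (univ : Set Pt))

/-- `‖∇f‖_{H^k}²`. -/
def gradHSq (k : ℕ) (f : Pt → ℝ) : ℝ := ∑ i, hSq k (pd i f)

/-- `‖∇_h∇f‖_{H^k}²`. -/
def gradHHSq (k : ℕ) (f : Pt → ℝ) : ℝ := ∑ i ∈ hIdx, ∑ j, hSq k (pd i (pd j f))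

/-- `‖v‖_{H^k}²` for a vector field. -/
def vecHSq (k : ℕ) (v : Fin 3 → Pt → ℝ) : ℝ := ∑ j, hSq k (v j)

/-- `‖∇v‖_{H^k}²` for a vector field. -/
def gradVecHSq (k : ℕ) (v : Fin 3 → Pt → ℝ) : ℝ := ∑ j, gradHSq k (v j)

/-- `B_T²`. -/
def BTsq (T : ℝ) (ψ : ℝ → Pt → ℝ) (v : Fin 3 → ℝ → Pt → ℝ) : ℝ :=
  (supT T fun t => Real.sqrt (vecHSq 2 fun j => v j t)) ^ 2
  + (supT T fun t => Real.sqrt (gradHSq 2 (ψ t))) ^ 2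
  + (l2T T fun t => Real.sqrt (gradVecHSq 2 fun j => v j t)) ^ 2
  + (l2T T fun t => Real.sqrt (gradHHSq 1 (ψ t))) ^ 2

/-- `B_T`. -/
def BT (T : ℝ) (ψ : ℝ → Pt → ℝ) (v : Fin 3 → ℝ → Pt → ℝ) : ℝ := Real.sqrt (BTsq T ψ v)

/-- The transport equation `∂_tψ + v·∇ψ + v₃ = 0` on `s × ℝ³`. -/
def TransportEq (s : Set ℝ) (ψ : ℝ → Pt → ℝ) (v : Fin 3 → ℝ → Pt → ℝ) : Prop :=
  ∀ t ∈ s, ∀ x, deriv (fun τ => ψ τ x) t + (∑ i, v i t x * pd i (ψ t) x) + v 2 t x = 0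

/-- Divergence-free condition on `s × ℝ³`. -/
def DivFree (s : Set ℝ) (v : Fin 3 → ℝ → Pt → ℝ) : Prop :=
  ∀ t ∈ s, ∀ x, (∑ i, pd i (fun y => v i t y) x) = 0

/-- The momentum equations of system (S) on `s × ℝ³`. -/
def MomentumEq (s : Set ℝ) (ψ : ℝ → Pt → ℝ) (v : Fin 3 → ℝ → Pt → ℝ)
    (p : ℝ → Pt → ℝ) : Prop :=
  ∀ j : Fin 3, ∀ t ∈ s, ∀ x,
    deriv (fun τ => v j τ x) t + (∑ i, v i t x * pd i (v j t) x) - lapl (v j t) x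
      + pd j (p t) x + pd j (pd 2 (ψ t)) x + (if j = 2 then lapl (ψ t) x else 0)
    = - ∑ i, pd i (fun y => pd j (ψ t) y * pd i (ψ t) y) x

/-- The full system (S) on `s × ℝ³`. -/
def SolvesS (s : Set ℝ) (ψ : ℝ → Pt → ℝ) (v : Fin 3 → ℝ → Pt → ℝ)
    (p : ℝ → Pt → ℝ) : Prop :=
  TransportEq s ψ v ∧ MomentumEq s ψ v p ∧ DivFree s v

/-- Finiteness of the four norms entering `B_T`. -/
def FiniteClass (T : ℝ) (ψ : ℝ → Pt → ℝ) (v : Fin 3 → ℝ → Pt → ℝ) : Prop :=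
  BddAbove ((fun t => Real.sqrt (vecHSq 2 fun j => v j t)) '' Icc 0 T) ∧
  BddAbove ((fun t => Real.sqrt (gradHSq 2 (ψ t))) '' Icc 0 T) ∧
  IntervalIntegrable (fun t => gradVecHSq 2 fun j => v j t) volume 0 T ∧
  IntervalIntegrable (fun t => gradHHSq 1 (ψ t)) volume 0 T

theorem ennreal_sq_lintegral_mul_le {α : Type*} [MeasurableSpace α] {μ : Measure α}
    {f g : α → ℝ≥0∞} (hf : Measurable f) (hg : Measurable g) :
    (∫⁻ x, f x * g x ∂μ) ^ 2 ≤ (∫⁻ x, f x ^ 2 ∂μ) * ∫⁻ x, g x ^ 2 ∂μ := by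
  have h := ENNReal.lintegral_mul_le_Lp_mul_Lq μ Real.HolderConjugate.two_two
    hf.aemeasurable hg.aemeasurable
  have h2 := pow_le_pow_left' h 2
  simpa only [Pi.mul_apply, ENNReal.rpow_two, mul_pow, ← ENNReal.rpow_mul_natCast, one_div,
    Nat.cast_ofNat, inv_mul_cancel₀ (two_ne_zero (α := ℝ)), ENNReal.rpow_one] using h2

theorem ennreal_two_mul_le_add_sq (a b : ℝ≥0∞) : 2 * (a * b) ≤ a ^ 2 + b ^ 2 := by
  wlog hab : a ≤ b generalizing a b
  · rw [mul_comm a b, add_comm]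
    exact this b a (le_of_not_ge hab)
  obtain ⟨c, rfl⟩ := exists_add_of_le hab
  calc 2 * (a * (a + c)) ≤ 2 * (a * (a + c)) + c ^ 2 := le_self_add
    _ = a ^ 2 + (a + c) ^ 2 := by ring

/-- A two-dimensional Ladyzhenskaya inequality for functions whose squares are controlled by line
integrals. -/
theorem lintegral_prod_pow_four_le {g a b : ℝ × ℝ → ℝ≥0∞}
    (hg : Measurable g) (ha : Measurable a) (hb : Measurable b)
    (h₁ : ∀ x y, g (x, y) ^ 2 ≤ 2 * ∫⁻ s, g (s, y) * a (s, y))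
    (h₂ : ∀ x y, g (x, y) ^ 2 ≤ 2 * ∫⁻ s, g (x, s) * b (x, s)) :
    ∫⁻ q, g q ^ 4 ≤ 2 * (∫⁻ q, g q ^ 2) * ((∫⁻ q, a q ^ 2) + ∫⁻ q, b q ^ 2) := by
  set A : ℝ → ℝ≥0∞ := fun y => 2 * ∫⁻ s, g (s, y) * a (s, y)
  set B : ℝ → ℝ≥0∞ := fun x => 2 * ∫⁻ s, g (x, s) * b (x, s)
  have hga : Measurable fun q => g q * a q := hg.mul ha
  have hgb : Measurable fun q => g q * b q := hg.mul hb
  have hA : Measurable A := hga.lintegral_prod_left.const_mul 2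
  have hB : Measurable B := hgb.lintegral_prod_right.const_mul 2
  have hAI : ∫⁻ y, A y = 2 * ∫⁻ q, g q * a q := by
    rw [lintegral_const_mul _ hga.lintegral_prod_left, Measure.volume_eq_prod,
      lintegral_prod_symm _ hga.aemeasurable]
  have hBI : ∫⁻ x, B x = 2 * ∫⁻ q, g q * b q := by
    rw [lintegral_const_mul _ hgb.lintegral_prod_right, Measure.volume_eq_prod,
      lintegral_prod _ hgb.aemeasurable]
  calc ∫⁻ q, g q ^ 4 ≤ ∫⁻ q : ℝ × ℝ, B q.1 * A q.2 := by
        refine lintegral_mono fun q => ?_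
        calc g q ^ 4 = g (q.1, q.2) ^ 2 * g (q.1, q.2) ^ 2 := by ring
          _ ≤ B q.1 * A q.2 := mul_le_mul' (h₂ _ _) (h₁ _ _)
    _ = (∫⁻ x, B x) * ∫⁻ y, A y := lintegral_prod_mul hB.aemeasurable hA.aemeasurable
    _ = 2 * (2 * ((∫⁻ q, g q * a q) * ∫⁻ q, g q * b q)) := by rw [hAI, hBI]; ring
    _ ≤ 2 * ((∫⁻ q, g q * a q) ^ 2 + (∫⁻ q, g q * b q) ^ 2) := by
        gcongr; exact ennreal_two_mul_le_add_sq _ _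
    _ ≤ 2 * ((∫⁻ q, g q ^ 2) * (∫⁻ q, a q ^ 2) + (∫⁻ q, g q ^ 2) * ∫⁻ q, b q ^ 2) := by
        gcongr
        · exact ennreal_sq_lintegral_mul_le hg ha
        · exact ennreal_sq_lintegral_mul_le hg hb
    _ = _ := by ring

theorem volume_preserving_vecCons :
    MeasurePreserving (fun p : ℝ × ℝ × ℝ => (![p.2.1, p.2.2, p.1] : Pt)) := by
  have h := (volume_preserving_piFinSuccAbove (fun _ : Fin 3 => ℝ) 2).symm _ |>.comp
    ((MeasurePreserving.id (volume : Measure ℝ)).prod ((volume_preserving_finTwoArrow ℝ).symm _))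
  have he : (fun p : ℝ × ℝ × ℝ => (![p.2.1, p.2.2, p.1] : Pt)) =
      (MeasurableEquiv.piFinSuccAbove (fun _ : Fin 3 => ℝ) 2).symm ∘
        Prod.map id MeasurableEquiv.finTwoArrow.symm := by
    ext p i
    fin_cases i <;> rfl
  rw [he]
  exact h

theorem measurable_vecCons : Measurable fun p : ℝ × ℝ × ℝ => (![p.2.1, p.2.2, p.1] : Pt) :=
  volume_preserving_vecCons.measurable

theorem lintegral_pt {F : Pt → ℝ≥0∞} (hF : Measurable F) :
    ∫⁻ p, F p = ∫⁻ z : ℝ, ∫⁻ q : ℝ × ℝ, F ![q.1, q.2, z] := by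
  rw [← volume_preserving_vecCons.lintegral_comp hF, Measure.volume_eq_prod,
    lintegral_prod (fun p : ℝ × ℝ × ℝ => F ![p.2.1, p.2.2, p.1])
      (hF.comp measurable_vecCons).aemeasurable]

/-- An anisotropic Ladyzhenskaya inequality: only the horizontal derivatives appear in the second
factor. -/
theorem lintegral_pow_four_le {G : Pt → ℝ≥0∞} {D : Fin 3 → Pt → ℝ≥0∞}
    (hG : Measurable G) (hD : ∀ i, Measurable (D i))
    (h : ∀ i p, G p ^ 2 ≤
      2 * ∫⁻ s, G (Function.update p i s) * D i (Function.update p i s)) :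
    ∫⁻ p, G p ^ 4 ≤
      2 * ((∫⁻ p, G p ^ 2) + ∫⁻ p, D 2 p ^ 2) * ((∫⁻ p, D 0 p ^ 2) + ∫⁻ p, D 1 p ^ 2) := by
  have hz (z : ℝ) : Measurable fun q : ℝ × ℝ => (![q.1, q.2, z] : Pt) :=
    measurable_vecCons.comp (measurable_const.prodMk measurable_id)
  have u0 (x y z s : ℝ) : Function.update (![x, y, z] : Pt) 0 s = ![s, y, z] := by
    ext i; fin_cases i <;> rfl
  have u1 (x y z s : ℝ) : Function.update (![x, y, z] : Pt) 1 s = ![x, s, z] := by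
    ext i; fin_cases i <;> rfl
  have u2 (x y z s : ℝ) : Function.update (![x, y, z] : Pt) 2 s = ![x, y, s] := by
    ext i; fin_cases i <;> rfl
  have hslice (z : ℝ) : ∫⁻ q : ℝ × ℝ, G ![q.1, q.2, z] ^ 2 ≤
      (∫⁻ p, G p ^ 2) + ∫⁻ p, D 2 p ^ 2 := by
    have hGD : Measurable fun p => G p * D 2 p := hG.mul (hD 2)
    calc ∫⁻ q : ℝ × ℝ, G ![q.1, q.2, z] ^ 2
        ≤ ∫⁻ q : ℝ × ℝ, 2 * ∫⁻ s, G ![q.1, q.2, s] * D 2 ![q.1, q.2, s] :=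
          lintegral_mono fun q => by simpa only [u2] using h 2 ![q.1, q.2, z]
      _ = 2 * ∫⁻ p, G p * D 2 p := by
          have hm : Measurable fun p : ℝ × ℝ × ℝ =>
              G ![p.2.1, p.2.2, p.1] * D 2 ![p.2.1, p.2.2, p.1] := hGD.comp measurable_vecCons
          rw [← volume_preserving_vecCons.lintegral_comp hGD, Measure.volume_eq_prod ℝ (ℝ × ℝ),
            lintegral_prod_symm _ hm.aemeasurable]
          exact lintegral_const_mul _ hm.lintegral_prod_left'
      _ = ∫⁻ p, 2 * (G p * D 2 p) := (lintegral_const_mul _ hGD).symm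
      _ ≤ ∫⁻ p, (G p ^ 2 + D 2 p ^ 2) :=
          lintegral_mono fun p => ennreal_two_mul_le_add_sq _ _
      _ = _ := lintegral_add_left (hG.pow_const 2) _
  have hD2 (i) : Measurable fun z : ℝ => ∫⁻ q : ℝ × ℝ, D i ![q.1, q.2, z] ^ 2 :=
    (((hD i).pow_const 2).comp measurable_vecCons).lintegral_prod_right'
  rw [lintegral_pt (hG.pow_const 4), lintegral_pt ((hD 0).pow_const 2),
    lintegral_pt ((hD 1).pow_const 2), ← lintegral_add_left (hD2 0),
    ← lintegral_const_mul _ (by exact (hD2 0).add (hD2 1))]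
  refine lintegral_mono fun z => ?_
  refine (lintegral_prod_pow_four_le (g := fun q => G ![q.1, q.2, z])
    (a := fun q => D 0 ![q.1, q.2, z]) (b := fun q => D 1 ![q.1, q.2, z])
    (hG.comp (hz z)) ((hD 0).comp (hz z)) ((hD 1).comp (hz z)) ?_ ?_).trans ?_
  · intro x y
    simpa only [u0] using h 0 ![x, y, z]
  · intro x y
    simpa only [u1] using h 1 ![x, y, z]
  · gcongr
    exact hslice z

theorem enorm_le_lintegral_of_tendsto_atBot {u u' : ℝ → ℝ} (hu : ∀ x, HasDerivAt u (u' x) x)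
    (hu' : Continuous u') (h0 : Tendsto u atBot (nhds 0)) (x : ℝ) :
    ‖u x‖ₑ ≤ ∫⁻ s, ‖u' s‖ₑ := by
  by_cases hfin : ∫⁻ s, ‖u' s‖ₑ = ⊤
  · simp [hfin]
  have hint : Integrable u' := ⟨hu'.aestronglyMeasurable, lt_top_iff_ne_top.2 hfin⟩
  have h := integral_Iic_of_hasDerivAt_of_tendsto' (a := x) (fun y _ => hu y)
    hint.integrableOn h0
  rw [sub_zero] at h
  rw [← h]
  exact (enorm_integral_le_lintegral_enorm _).trans (setLIntegral_le_lintegral _ _)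

namespace IsSchwartz

/-- The bundled Schwartz function. -/
def toMap {f : Pt → ℝ} (hf : IsSchwartz f) : SchwartzMap Pt ℝ := ⟨f, hf.1, hf.2⟩

theorem coe_toMap {f : Pt → ℝ} (hf : IsSchwartz f) : ⇑hf.toMap = f := rfl

theorem of_map (f : SchwartzMap Pt ℝ) : IsSchwartz f := ⟨f.smooth', f.decay'⟩

theorem pd {f : Pt → ℝ} (hf : IsSchwartz f) (i : Fin 3) : IsSchwartz (pd i f) :=
  of_map (LineDeriv.lineDerivOp (Pi.single i (1 : ℝ) : Pt) hf.toMap)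

theorem iterate_pd {f : Pt → ℝ} (hf : IsSchwartz f) (i : Fin 3) (n : ℕ) :
    IsSchwartz ((_root_.pd i)^[n] f) := by
  induction n with
  | zero => exact hf
  | succ n ih => rw [Function.iterate_succ_apply']; exact ih.pd i

theorem pdM {f : Pt → ℝ} (hf : IsSchwartz f) (α : Fin 3 → ℕ) : IsSchwartz (pdM α f) :=
  ((hf.iterate_pd 2 _).iterate_pd 1 _).iterate_pd 0 _

theorem continuous {f : Pt → ℝ} (hf : IsSchwartz f) : Continuous f := hf.1.continuous

theorem tendsto_cocompact {f : Pt → ℝ} (hf : IsSchwartz f) :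
    Tendsto f (cocompact Pt) (nhds 0) :=
  hf.toMap.tendsto_cocompact

theorem integrable_sq {f : Pt → ℝ} (hf : IsSchwartz f) : Integrable fun x => f x ^ 2 :=
  (hf.toMap.memLp 2 volume).integrable_sq

theorem integrable_pow_four {f : Pt → ℝ} (hf : IsSchwartz f) : Integrable fun x => f x ^ 4 := by
  have h := (hf.toMap.memLp (4 : ℕ) volume).integrable_norm_pow (by norm_num)
  simpa [coe_toMap, Even.pow_abs (show Even 4 by decide)] using h

theorem enorm_sq_le {g : Pt → ℝ} (hg : IsSchwartz g) (i : Fin 3) (p : Pt) :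
    ‖g p‖ₑ ^ 2 ≤ 2 * ∫⁻ s, ‖g (Function.update p i s)‖ₑ *
      ‖_root_.pd i g (Function.update p i s)‖ₑ := by
  have hup : Continuous (Function.update p i) := continuous_const.update i continuous_id
  have hlim : Tendsto (fun s => g (Function.update p i s)) atBot (nhds 0) := by
    refine hg.tendsto_cocompact.comp ?_
    rw [← Metric.cobounded_eq_cocompact, ← tendsto_norm_atTop_iff_cobounded]
    refine tendsto_atTop_mono (fun s => ?_) tendsto_abs_atBot_atTop
    simpa using norm_le_pi_norm (Function.update p i s) i
  have hder (s : ℝ) : HasDerivAt (fun s => g (Function.update p i s) ^ 2)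
      (2 * (g (Function.update p i s) * _root_.pd i g (Function.update p i s))) s := by
    have h1 : HasDerivAt (fun s => g (Function.update p i s))
        (_root_.pd i g (Function.update p i s)) s :=
      (hg.1.differentiable (by simp) _).hasFDerivAt.comp_hasDerivAt s (hasDerivAt_update p i s)
    exact (h1.pow 2).congr_deriv (by norm_num [mul_assoc])
  have h := enorm_le_lintegral_of_tendsto_atBot hder
    (continuous_const.mul ((hg.continuous.comp hup).mul ((hg.pd i).continuous.comp hup)))
    (by simpa using hlim.pow 2) (p i)
  rw [Function.update_eq_self] at h
  have e2 : ‖(2 : ℝ)‖ₑ = 2 := by simp [enorm_eq_nnnorm]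
  simp only [enorm_pow, enorm_mul, e2] at h
  rwa [lintegral_const_mul' _ _ (by simp)] at h

theorem lintegral_enorm_sq {f : Pt → ℝ} (hf : IsSchwartz f) :
    ∫⁻ x, ‖f x‖ₑ ^ 2 = ENNReal.ofReal (∫ x, f x ^ 2) := by
  rw [ofReal_integral_eq_lintegral_ofReal hf.integrable_sq (ae_of_all _ fun x => sq_nonneg _)]
  refine lintegral_congr fun x => ?_
  rw [← enorm_pow, Real.enorm_of_nonneg (sq_nonneg _)]

theorem lintegral_enorm_pow_four {f : Pt → ℝ} (hf : IsSchwartz f) :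
    ∫⁻ x, ‖f x‖ₑ ^ 4 = ENNReal.ofReal (∫ x, f x ^ 4) := by
  rw [ofReal_integral_eq_lintegral_ofReal hf.integrable_pow_four
    (ae_of_all _ fun x => Even.pow_nonneg (by decide) _)]
  refine lintegral_congr fun x => ?_
  rw [← enorm_pow, Real.enorm_of_nonneg (Even.pow_nonneg (by decide) _)]

theorem integral_pow_four_le {g : Pt → ℝ} (hg : IsSchwartz g) :
    ∫ x, g x ^ 4 ≤ 2 * ((∫ x, g x ^ 2) + ∫ x, _root_.pd 2 g x ^ 2) *
      ((∫ x, _root_.pd 0 g x ^ 2) + ∫ x, _root_.pd 1 g x ^ 2) := by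
  have h := lintegral_pow_four_le (G := fun x => ‖g x‖ₑ) (D := fun i x => ‖_root_.pd i g x‖ₑ)
    hg.continuous.measurable.enorm (fun i => (hg.pd i).continuous.measurable.enorm)
    hg.enorm_sq_le
  have hnn (f : Pt → ℝ) : 0 ≤ ∫ x, f x ^ 2 := integral_nonneg fun x => sq_nonneg _
  have h0 := hnn g
  have h1 := hnn (_root_.pd 0 g)
  have h2 := hnn (_root_.pd 1 g)
  have h3 := hnn (_root_.pd 2 g)
  rw [hg.lintegral_enorm_pow_four, hg.lintegral_enorm_sq, (hg.pd 0).lintegral_enorm_sq,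
    (hg.pd 1).lintegral_enorm_sq, (hg.pd 2).lintegral_enorm_sq,
    ← ENNReal.ofReal_add h0 h3, ← ENNReal.ofReal_add h1 h2,
    show (2 : ℝ≥0∞) = ENNReal.ofReal 2 by simp, ← ENNReal.ofReal_mul (by norm_num),
    ← ENNReal.ofReal_mul (by positivity)] at h
  exact (ENNReal.ofReal_le_ofReal_iff (by positivity)).1 h

end IsSchwartz

theorem midx_mono {k l : ℕ} (h : k ≤ l) : midx k ⊆ midx l := by
  intro α
  simp only [midx, Finset.mem_filter, Fintype.mem_piFinset, Finset.mem_range]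
  exact fun hα => ⟨fun i => (hα.1 i).trans_le (by omega), hα.2.trans h⟩

theorem midx_zero : midx 0 = {0} := by decide

theorem integral_pdM_mul_self_nonneg (α : Fin 3 → ℕ) (f : Pt → ℝ) :
    0 ≤ ∫ x : Pt, pdM α f x * pdM α f x :=
  integral_nonneg fun _ => mul_self_nonneg _

theorem hSq_nonneg (k : ℕ) (f : Pt → ℝ) : 0 ≤ hSq k f :=
  Finset.sum_nonneg fun α _ => integral_pdM_mul_self_nonneg α f

theorem hSq_mono {k l : ℕ} (h : k ≤ l) (f : Pt → ℝ) : hSq k f ≤ hSq l f :=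
  Finset.sum_le_sum_of_subset_of_nonneg (midx_mono h) fun α _ _ =>
    integral_pdM_mul_self_nonneg α f

theorem hSq_zero (f : Pt → ℝ) : hSq 0 f = ∫ x, f x ^ 2 := by
  simp [hSq, hInner, midx_zero, pdM, sq]

theorem integral_sq_add_le_hSq_one (f : Pt → ℝ) :
    (∫ x, f x ^ 2) + ∫ x, pd 2 f x ^ 2 ≤ hSq 1 f := by
  have hs : ({0, Pi.single 2 1} : Finset (Fin 3 → ℕ)) ⊆ midx 1 := by decide
  have h := Finset.sum_le_sum_of_subset_of_nonneg hs fun α _ _ =>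
    integral_pdM_mul_self_nonneg α f
  rw [Finset.sum_pair (by decide)] at h
  simpa [pdM, sq, hSq, hInner] using h

theorem gradHSq_nonneg (k : ℕ) (f : Pt → ℝ) : 0 ≤ gradHSq k f :=
  Finset.sum_nonneg fun _ _ => hSq_nonneg _ _

theorem gradHSq_mono {k l : ℕ} (h : k ≤ l) (f : Pt → ℝ) : gradHSq k f ≤ gradHSq l f :=
  Finset.sum_le_sum fun _ _ => hSq_mono h _

theorem gradHHSq_nonneg (k : ℕ) (f : Pt → ℝ) : 0 ≤ gradHHSq k f :=
  Finset.sum_nonneg fun _ _ => Finset.sum_nonneg fun _ _ => hSq_nonneg _ _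

theorem gradHHSq_mono {k l : ℕ} (h : k ≤ l) (f : Pt → ℝ) : gradHHSq k f ≤ gradHHSq l f :=
  Finset.sum_le_sum fun _ _ => Finset.sum_le_sum fun _ _ => hSq_mono h _

theorem gradHHSq_zero (f : Pt → ℝ) :
    gradHHSq 0 f = ∑ j, ((∫ x, pd 0 (pd j f) x ^ 2) + ∫ x, pd 1 (pd j f) x ^ 2) := by
  simp [gradHHSq, hIdx, hSq_zero, Finset.sum_add_distrib]

/-- The estimate at a fixed time. -/
theorem IsSchwartz.integral_grad_pow_four_le {f : Pt → ℝ} (hf : IsSchwartz f) :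
    ∫ x : Pt, (∑ i, _root_.pd i f x ^ 2) ^ 2 ≤ 6 * gradHSq 1 f * gradHHSq 0 f := by
  have h4 (i : Fin 3) := (hf.pd i).integrable_pow_four
  set h : Fin 3 → ℝ := fun j => (∫ x, _root_.pd 0 (_root_.pd j f) x ^ 2) + ∫ x, _root_.pd 1 (_root_.pd j f) x ^ 2
  have hh (j) : 0 ≤ h j := add_nonneg (integral_nonneg fun _ => sq_nonneg _)
    (integral_nonneg fun _ => sq_nonneg _)
  calc ∫ x : Pt, (∑ i, _root_.pd i f x ^ 2) ^ 2 ≤ ∫ x : Pt, 3 * ∑ i, _root_.pd i f x ^ 4 := by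
        refine integral_mono_of_nonneg (ae_of_all _ fun x => sq_nonneg _)
          ((integrable_finsetSum _ fun i _ => h4 i).const_mul 3) (ae_of_all _ fun x => ?_)
        have := sq_sum_le_card_mul_sum_sq (s := Finset.univ) (f := fun i => _root_.pd i f x ^ 2)
        simpa [← pow_mul] using this
    _ = 3 * ∑ i, ∫ x, _root_.pd i f x ^ 4 := by
        rw [integral_const_mul, integral_finsetSum _ fun i _ => h4 i]
    _ ≤ 3 * ∑ i, 2 * gradHSq 1 f * h i := by
        gcongr with i
        refine (hf.pd i).integral_pow_four_le.trans ?_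
        refine mul_le_mul_of_nonneg_right ?_ (hh i)
        gcongr
        exact (integral_sq_add_le_hSq_one _).trans
          (Finset.single_le_sum (f := fun i => hSq 1 (_root_.pd i f)) (fun i _ => hSq_nonneg _ _)
            (Finset.mem_univ i))
    _ = 6 * gradHSq 1 f * gradHHSq 0 f := by
        rw [← Finset.mul_sum, gradHHSq_zero]
        ring

theorem SmoothOn2.mono {s t : Set ℝ} {f : ℝ → Pt → ℝ} (hf : SmoothOn2 t f) (h : s ⊆ t) :
    SmoothOn2 s f :=
  ContDiffOn.mono hf (prod_mono h Subset.rfl)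

theorem SmoothOn2.pd {s : Set ℝ} (hs : IsOpen s) {f : ℝ → Pt → ℝ} (hf : SmoothOn2 s f)
    (i : Fin 3) : SmoothOn2 s fun t => pd i (f t) := by
  have ho : IsOpen (s ×ˢ (univ : Set Pt)) := hs.prod isOpen_univ
  have h1 : ContDiffOn ℝ (⊤ : ℕ∞) (fderiv ℝ fun q : ℝ × Pt => f q.1 q.2) (s ×ˢ univ) :=
    ContDiffOn.fderiv_of_isOpen hf ho (by simp)
  refine (h1.clm_apply (contDiffOn_const (c := ((0 : ℝ), (Pi.single i 1 : Pt))))).congr ?_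
  rintro ⟨t, x⟩ hq
  have hd : DifferentiableAt ℝ (fun q : ℝ × Pt => f q.1 q.2) (t, x) :=
    (ContDiffOn.contDiffAt hf (ho.mem_nhds hq)).differentiableAt (by simp)
  have hc : HasFDerivAt (f t) _ x :=
    HasFDerivAt.comp x (g := fun q : ℝ × Pt => f q.1 q.2) hd.hasFDerivAt
      (hasFDerivAt_prodMk_right t x)
  simp [_root_.pd, hc.fderiv]

theorem SmoothOn2.aestronglyMeasurable_integral_sq {s : Set ℝ} (hs : IsOpen s)
    {f : ℝ → Pt → ℝ} (hf : SmoothOn2 s f) :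
    AEStronglyMeasurable (fun t => ∫ x, f t x ^ 2) (volume.restrict s) := by
  have h : AEStronglyMeasurable (fun q : ℝ × Pt => f q.1 q.2 ^ 2)
      ((volume.restrict s).prod volume) := by
    have hm := ((ContDiffOn.continuousOn hf).pow 2).aestronglyMeasurable
      (μ := volume.prod volume) (hs.measurableSet.prod MeasurableSet.univ)
    rwa [← Measure.prod_restrict, Measure.restrict_univ] at hm
  exact h.integral_prod_right'

theorem SmoothOn2.aestronglyMeasurable_gradHHSq_zero {s : Set ℝ} (hs : IsOpen s)
    {ψ : ℝ → Pt → ℝ} (hψ : SmoothOn2 s ψ) :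
    AEStronglyMeasurable (fun t => gradHHSq 0 (ψ t)) (volume.restrict s) := by
  simp only [gradHHSq_zero]
  exact Finset.aestronglyMeasurable_fun_sum _ fun j _ =>
    (((hψ.pd hs j).pd hs 0).aestronglyMeasurable_integral_sq hs).add
      (((hψ.pd hs j).pd hs 1).aestronglyMeasurable_integral_sq hs)

theorem SmoothOn2.intervalIntegrable_gradHHSq_zero {T : ℝ} (hT : 0 ≤ T) {ψ : ℝ → Pt → ℝ}
    (hψ : SmoothOn2 (Icc 0 T) ψ)
    (hint : IntervalIntegrable (fun t => gradHHSq 1 (ψ t)) volume 0 T) :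
    IntervalIntegrable (fun t => gradHHSq 0 (ψ t)) volume 0 T := by
  rw [intervalIntegrable_iff_integrableOn_Ioo_of_le hT] at hint ⊢
  refine Integrable.mono' hint
    ((hψ.mono Ioo_subset_Icc_self).aestronglyMeasurable_gradHHSq_zero isOpen_Ioo)
    (ae_of_all _ fun t => ?_)
  rw [Real.norm_of_nonneg (gradHHSq_nonneg _ _)]
  exact gradHHSq_mono zero_le_one _

theorem supT_sqrt_nonneg (T : ℝ) (g : ℝ → ℝ) : 0 ≤ supT T fun t => Real.sqrt (g t) :=
  Real.sSup_nonneg (by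
    rintro _ ⟨s, -, rfl⟩
    exact Real.sqrt_nonneg _)

theorem gradHSq_one_le_supT_sq {T : ℝ} {ψ : ℝ → Pt → ℝ}
    (hb : BddAbove ((fun t => Real.sqrt (gradHSq 2 (ψ t))) '' Icc 0 T)) {t : ℝ}
    (ht : t ∈ Icc 0 T) :
    gradHSq 1 (ψ t) ≤ (supT T fun t => Real.sqrt (gradHSq 1 (ψ t))) ^ 2 := by
  have hb1 : BddAbove ((fun t => Real.sqrt (gradHSq 1 (ψ t))) '' Icc 0 T) := by
    obtain ⟨M, hM⟩ := hb
    refine ⟨M, ?_⟩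
    rintro _ ⟨s, hs, rfl⟩
    exact (Real.sqrt_le_sqrt (gradHSq_mono one_le_two _)).trans (hM (mem_image_of_mem _ hs))
  exact (Real.sqrt_le_left (supT_sqrt_nonneg _ _)).1 (le_csSup hb1 (mem_image_of_mem _ ht))

/-- Lemma 2.2, first inequality:
`‖∇ψ‖_{L⁴_T(L⁴)} ≤ C ‖∇_h∇ψ‖_{L²_T(L²)}^{1/2} ‖∇ψ‖_{L^∞_T(H¹)}^{1/2}`. -/
theorem stmt_1 :
    ∃ C : ℝ, 0 < C ∧ ∀ T : ℝ, 0 < T → ∀ ψ : ℝ → Pt → ℝ,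
      SmoothOn2 (Icc 0 T) ψ → (∀ t ∈ Icc (0:ℝ) T, IsSchwartz (ψ t)) →
      BddAbove ((fun t => Real.sqrt (gradHSq 2 (ψ t))) '' Icc 0 T) →
      IntervalIntegrable (fun t => gradHHSq 1 (ψ t)) volume 0 T →
      l4T T (fun t => (∫ x : Pt, (∑ i, (pd i (ψ t) x) ^ 2) ^ 2) ^ ((1:ℝ)/4)) ≤
        C * (l2T T fun t => Real.sqrt (gradHHSq 0 (ψ t))) ^ ((1:ℝ)/2)
          * (supT T fun t => Real.sqrt (gradHSq 1 (ψ t))) ^ ((1:ℝ)/2) := by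
  refine ⟨2, two_pos, fun T hT ψ hψ hS hb hint => ?_⟩
  have hM0 : 0 ≤ supT T fun t => Real.sqrt (gradHSq 1 (ψ t)) := supT_sqrt_nonneg _ _
  have hle (t) (ht : t ∈ Icc 0 T) := gradHSq_one_le_supT_sq hb ht
  set M := supT T fun t => Real.sqrt (gradHSq 1 (ψ t))
  have hX0 (t : ℝ) : 0 ≤ ∫ x : Pt, (∑ i, pd i (ψ t) x ^ 2) ^ 2 :=
    integral_nonneg fun _ => sq_nonneg _
  have hX (t : ℝ) : ((∫ x : Pt, (∑ i, pd i (ψ t) x ^ 2) ^ 2) ^ ((1:ℝ)/4)) ^ 4 =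
      ∫ x : Pt, (∑ i, pd i (ψ t) x ^ 2) ^ 2 := by
    rw [← Real.rpow_mul_natCast (hX0 t)]
    norm_num
  have hint0 := hψ.intervalIntegrable_gradHHSq_zero hT.le hint
  have hI0 : 0 ≤ ∫ t in (0:ℝ)..T, gradHHSq 0 (ψ t) :=
    intervalIntegral.integral_nonneg hT.le fun t _ => gradHHSq_nonneg _ _
  simp only [l4T, l2T, hX, Real.sq_sqrt (gradHHSq_nonneg _ _)]
  set I := ∫ t in (0:ℝ)..T, gradHHSq 0 (ψ t)
  have hmain : ∫ t in (0:ℝ)..T, ∫ x : Pt, (∑ i, pd i (ψ t) x ^ 2) ^ 2 ≤ 16 * I * M ^ 2 := by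
    calc ∫ t in (0:ℝ)..T, ∫ x : Pt, (∑ i, pd i (ψ t) x ^ 2) ^ 2
        ≤ ∫ t in (0:ℝ)..T, 6 * M ^ 2 * gradHHSq 0 (ψ t) := by
          rw [intervalIntegral.integral_of_le hT.le, intervalIntegral.integral_of_le hT.le]
          refine integral_mono_of_nonneg (ae_of_all _ hX0) (hint0.1.const_mul _) ?_
          refine (ae_restrict_iff' measurableSet_Ioc).2 (ae_of_all _ fun t ht => ?_)
          have ht' := Ioc_subset_Icc_self ht
          refine (hS t ht').integral_grad_pow_four_le.trans ?_
          have := gradHHSq_nonneg 0 (ψ t)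
          change _ ≤ 6 * M ^ 2 * gradHHSq 0 (ψ t)
          gcongr
          exact hle t ht'
      _ = 6 * M ^ 2 * I := intervalIntegral.integral_const_mul _ _
      _ ≤ 16 * I * M ^ 2 := by nlinarith [mul_nonneg hI0 (sq_nonneg M)]
  refine (Real.rpow_le_rpow (intervalIntegral.integral_nonneg hT.le fun t _ => hX0 t) hmain
    (by norm_num)).trans_eq ?_
  rw [Real.mul_rpow (by positivity) (by positivity), Real.mul_rpow (by norm_num) hI0,
    Real.sqrt_eq_rpow, ← Real.rpow_mul hI0, ← Real.rpow_natCast M 2, ← Real.rpow_mul hM0,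
    show (16 : ℝ) = 2 ^ (4 : ℝ) by norm_num, ← Real.rpow_mul (by norm_num)]
  norm_num

end
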